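/- arXiv:1903.08338 — 4 statements merged into one kernel-verified Lean document; each statement's English description precedes it below -/
import Mathlib

section
/- (Nonnegativity lemma) Let B=(b_{ij}) be an alternating sign matrix of size n and suppose R_{ij}^{kl} is an essential rectangle for B. Then b_{il} ≥ 0 and b_{jk} ≥ 0. -/
/-- An alternating sign matrix of size `n`, with entries indexed by `1..n`
(entries outside this range are irrelevant). -/
def IsASM (n : ℕ) (A : ℕ → ℕ → ℤ) : Prop :=
  (∀ i ∈ Finset.Icc 1 n, ∀ j ∈ Finset.Icc 1 n, A i j = -1 ∨ A i j = 0 ∨ A i j = 1) ∧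
  (∀ i ∈ Finset.Icc 1 n, ∀ j ∈ Finset.Icc 1 n,
      (∑ k ∈ Finset.Icc 1 j, A i k) = 0 ∨ (∑ k ∈ Finset.Icc 1 j, A i k) = 1) ∧
  (∀ i ∈ Finset.Icc 1 n, ∀ j ∈ Finset.Icc 1 n,
      (∑ k ∈ Finset.Icc 1 i, A k j) = 0 ∨ (∑ k ∈ Finset.Icc 1 i, A k j) = 1) ∧
  (∀ i ∈ Finset.Icc 1 n, (∑ k ∈ Finset.Icc 1 n, A i k) = 1) ∧
  (∀ j ∈ Finset.Icc 1 n, (∑ k ∈ Finset.Icc 1 n, A k j) = 1)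

/-- Corner sum matrix: `Ã(i,j) = Σ_{p ≤ i, q ≤ j} a_{pq}` (zero when `i = 0` or `j = 0`). -/
def cornerSum (A : ℕ → ℕ → ℤ) (i j : ℕ) : ℤ :=
  ∑ p ∈ Finset.Icc 1 i, ∑ q ∈ Finset.Icc 1 j, A p q

/-- `R_{ij}^{kl}` (for `1 ≤ i < j ≤ n`, `1 ≤ k < l ≤ n`) is an essential rectangle for `A`. -/
def EssRect (n : ℕ) (A : ℕ → ℕ → ℤ) (i j k l : ℕ) : Prop :=
  1 ≤ i ∧ i < j ∧ j ≤ n ∧ 1 ≤ k ∧ k < l ∧ l ≤ n ∧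
  ∀ p q, i ≤ p → p < j → k ≤ q → q < l →
    cornerSum A p k = cornerSum A p (k - 1) ∧
    cornerSum A p l = cornerSum A p (l - 1) + 1 ∧
    cornerSum A i q = cornerSum A (i - 1) q ∧
    cornerSum A j q = cornerSum A (j - 1) q + 1

/-- The bigrassmannian statistic `β(A) = Σ min(i,j) − Σ Ã(i,j)`. -/
def asmBeta (n : ℕ) (A : ℕ → ℕ → ℤ) : ℤ :=
  (∑ i ∈ Finset.Icc 1 n, ∑ j ∈ Finset.Icc 1 n, (min i j : ℤ)) -
    ∑ i ∈ Finset.Icc 1 n, ∑ j ∈ Finset.Icc 1 n, cornerSum A i j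

/-- ASM (Bruhat) order: `A ≤ B` iff `Ã(i,j) ≥ B̃(i,j)` for all `i, j`. -/
def ASMLE (n : ℕ) (A B : ℕ → ℕ → ℤ) : Prop :=
  ∀ i ∈ Finset.Icc 1 n, ∀ j ∈ Finset.Icc 1 n, cornerSum B i j ≤ cornerSum A i j

/-- The labelled ASM-graph edge relation `A →_{ij}^{kl} B`. -/
def ASMEdge (n : ℕ) (A B : ℕ → ℕ → ℤ) (i j k l : ℕ) : Prop :=
  EssRect n B i j k l ∧
  (∀ p q, i ≤ p → p < j → k ≤ q → q < l → cornerSum A p q = cornerSum B p q + 1) ∧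
  (∀ p q, p ≤ n → q ≤ n → ¬(i ≤ p ∧ p < j ∧ k ≤ q ∧ q < l) →
      cornerSum A p q = cornerSum B p q)

/-- The ASM-graph edge relation `A → B`. -/
def ASMEdgeRel (n : ℕ) (A B : ℕ → ℕ → ℤ) : Prop :=
  ∃ i j k l, ASMEdge n A B i j k l

/-- The `0/1` permutation matrix of a permutation of `ℕ`. -/
def PermMatrixZ (u : Equiv.Perm ℕ) : ℕ → ℕ → ℤ :=
  fun i j => if u i = j then 1 else 0

/-- A permutation (of `ℕ`, supported on `1..n`) is bigrassmannian: there is a unique pair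
`(i,j) ∈ [n-1]²` with `u⁻¹(i) > u⁻¹(i+1)` and `u(j) > u(j+1)`. -/
def IsBigrass (n : ℕ) (u : Equiv.Perm ℕ) : Prop :=
  ∃! p : ℕ × ℕ, (1 ≤ p.1 ∧ p.1 ≤ n - 1 ∧ 1 ≤ p.2 ∧ p.2 ≤ n - 1) ∧
    u.symm (p.1 + 1) < u.symm p.1 ∧ u (p.2 + 1) < u p.2

/-- The ASM Laurent monomial `x^A` evaluated at a real matrix `M`. -/
noncomputable def asmMon (n : ℕ) (A : ℕ → ℕ → ℤ) (M : ℕ → ℕ → ℝ) : ℝ :=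
  ∏ p ∈ Finset.Icc 1 n, ∏ q ∈ Finset.Icc 1 n, M p q ^ A p q

/-- A real matrix (indexed by `1..n`) is totally nonnegative: every minor is nonnegative. -/
def IsTNNReal (n : ℕ) (M : ℕ → ℕ → ℝ) : Prop :=
  ∀ (r : ℕ) (f g : Fin r → ℕ), StrictMono f → StrictMono g →
    (∀ a, f a ∈ Finset.Icc 1 n) → (∀ a, g a ∈ Finset.Icc 1 n) →
    0 ≤ (Matrix.of (fun a b => M (f a) (g b))).det
/-- A row's partial sum is the difference of consecutive corner sums. -/
theorem cornerSum_eq_add_row (A : ℕ → ℕ → ℤ) {i : ℕ} (hi : 1 ≤ i) (j : ℕ) :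
    cornerSum A i j = cornerSum A (i - 1) j + ∑ q ∈ Finset.Icc 1 j, A i q := by
  obtain ⟨m, rfl⟩ := Nat.exists_eq_add_of_le' hi
  simp only [cornerSum, Nat.add_sub_cancel]
  exact Finset.sum_Icc_succ_top (by omega) _

/-- A column's partial sum is the difference of consecutive corner sums. -/
theorem cornerSum_eq_add_col (A : ℕ → ℕ → ℤ) (i : ℕ) {j : ℕ} (hj : 1 ≤ j) :
    cornerSum A i j = cornerSum A i (j - 1) + ∑ p ∈ Finset.Icc 1 i, A p j := by
  obtain ⟨m, rfl⟩ := Nat.exists_eq_add_of_le' hj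
  simp only [cornerSum, Nat.add_sub_cancel, ← Finset.sum_add_distrib]
  exact Finset.sum_congr rfl fun p _ => Finset.sum_Icc_succ_top (by omega) _

/-- nonnegativity: if `R_{ij}^{kl}` is an essential rectangle for an ASM `B`,
then `b_{il} ≥ 0` and `b_{jk} ≥ 0`. -/
theorem essRect_nonneg (n : ℕ) (B : ℕ → ℕ → ℤ) (hB : IsASM n B)
    (i j k l : ℕ) (hR : EssRect n B i j k l) :
    0 ≤ B i l ∧ 0 ≤ B j k := by
  obtain ⟨-, hrow, hcol, -, -⟩ := hB
  obtain ⟨hi, hij, hjn, hk, hkl, hln, h⟩ := hR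
  constructor
  · obtain ⟨l, rfl⟩ := Nat.exists_eq_add_of_le' (show 1 ≤ l by omega)
    have h₀ := (h i l le_rfl hij (by omega) (by omega)).2.2.1
    have h₁ := cornerSum_eq_add_row B hi l
    have h₂ := Finset.sum_Icc_succ_top (show 1 ≤ l + 1 by omega) (B i)
    have h₃ := hrow i (Finset.mem_Icc.2 ⟨hi, by omega⟩) (l + 1)
      (Finset.mem_Icc.2 ⟨by omega, hln⟩)
    omega
  · obtain ⟨j, rfl⟩ := Nat.exists_eq_add_of_le' (show 1 ≤ j by omega)
    have h₀ := (h j k (by omega) (by omega) le_rfl hkl).1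
    have h₁ := cornerSum_eq_add_col B j hk
    have h₂ := Finset.sum_Icc_succ_top (show 1 ≤ j + 1 by omega) fun p => B p k
    have h₃ := hcol (j + 1) (Finset.mem_Icc.2 ⟨by omega, hjn⟩) k
      (Finset.mem_Icc.2 ⟨hk, by omega⟩)
    omega
end

section
/- Let A be an alternating sign matrix of size n. Then the following are equivalent: (1) A is the permutation matrix of a bigrassmannian permutation; (2) A has exactly one essential point, i.e. there is exactly one pair (i,k) with 1 ≤ i,k ≤ n−1 such that R_{i,i+1}^{k,k+1} is an essential rectangle for A. -/
/-- The corner sums `h` of an alternating sign matrix of size `n`: unit or zero steps in both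
directions, with the prescribed values on the boundary of the square `[0, n]²`. -/
structure IsCornerSumLike (n : ℕ) (h : ℕ → ℕ → ℤ) : Prop where
  zero_left : ∀ q, h 0 q = 0
  zero_right : ∀ p, h p 0 = 0
  step_left : ∀ p q, p + 1 ≤ n → q ≤ n → h (p + 1) q = h p q ∨ h (p + 1) q = h p q + 1
  step_right : ∀ p q, p ≤ n → q + 1 ≤ n → h p (q + 1) = h p q ∨ h p (q + 1) = h p q + 1
  last_left : ∀ q, q ≤ n → h n q = q
  last_right : ∀ p, p ≤ n → h p n = p

theorem cornerSum_succ_left (A : ℕ → ℕ → ℤ) (p q : ℕ) :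
    cornerSum A (p + 1) q = cornerSum A p q + ∑ k ∈ Finset.Icc 1 q, A (p + 1) k := by
  unfold cornerSum
  rw [Finset.sum_Icc_succ_top (by omega)]

theorem cornerSum_succ_right (A : ℕ → ℕ → ℤ) (p q : ℕ) :
    cornerSum A p (q + 1) = cornerSum A p q + ∑ k ∈ Finset.Icc 1 p, A k (q + 1) := by
  unfold cornerSum
  rw [← Finset.sum_add_distrib]
  refine Finset.sum_congr rfl fun a _ => ?_
  rw [Finset.sum_Icc_succ_top (by omega)]

theorem cornerSum_zero_left (A : ℕ → ℕ → ℤ) (q : ℕ) : cornerSum A 0 q = 0 := by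
  simp [cornerSum]

theorem cornerSum_zero_right (A : ℕ → ℕ → ℤ) (p : ℕ) : cornerSum A p 0 = 0 := by
  simp [cornerSum]

theorem entry_eq_cornerSum (A : ℕ → ℕ → ℤ) (p q : ℕ) :
    A (p + 1) (q + 1) = cornerSum A (p + 1) (q + 1) - cornerSum A p (q + 1)
      - cornerSum A (p + 1) q + cornerSum A p q := by
  rw [cornerSum_succ_left A p (q + 1), cornerSum_succ_left A p q,
    Finset.sum_Icc_succ_top (by omega)]
  ring

theorem IsASM.isCornerSumLike {n : ℕ} {A : ℕ → ℕ → ℤ} (hA : IsASM n A) :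
    IsCornerSumLike n (cornerSum A) := by
  obtain ⟨-, hrow, hcol, hrow', hcol'⟩ := hA
  refine ⟨cornerSum_zero_left A, cornerSum_zero_right A, fun p q hp hq => ?_, fun p q hp hq => ?_,
    fun q hq => ?_, fun p hp => ?_⟩
  · rw [cornerSum_succ_left]
    rcases Nat.eq_zero_or_pos q with rfl | hq0
    · simp
    · rcases hrow (p + 1) (by simp; omega) q (by simp; omega) with h | h <;> simp [h]
  · rw [cornerSum_succ_right]
    rcases Nat.eq_zero_or_pos p with rfl | hp0
    · simp
    · rcases hcol p (by simp; omega) (q + 1) (by simp; omega) with h | h <;> simp [h]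
  · induction q with
    | zero => simp [cornerSum_zero_right]
    | succ q ih =>
      rw [cornerSum_succ_right, ih (by omega), hcol' (q + 1) (by simp; omega)]
      push_cast; rfl
  · induction p with
    | zero => simp [cornerSum_zero_left]
    | succ p ih =>
      rw [cornerSum_succ_left, ih (by omega), hrow' (p + 1) (by simp; omega)]
      push_cast; rfl

theorem essRect_point_iff {n : ℕ} {A : ℕ → ℕ → ℤ} {i k : ℕ} :
    EssRect n A i (i + 1) k (k + 1) ↔ 1 ≤ i ∧ i + 1 ≤ n ∧ 1 ≤ k ∧ k + 1 ≤ n ∧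
      cornerSum A i k = cornerSum A i (k - 1) ∧ cornerSum A i (k + 1) = cornerSum A i k + 1 ∧
      cornerSum A i k = cornerSum A (i - 1) k ∧
      cornerSum A (i + 1) k = cornerSum A i k + 1 := by
  constructor
  · rintro ⟨h1, -, h3, h4, -, h6, h⟩
    have := h i k le_rfl (by omega) le_rfl (by omega)
    simp only [Nat.add_sub_cancel] at this
    exact ⟨h1, h3, h4, h6, this⟩
  · rintro ⟨h1, h3, h4, h6, h⟩
    refine ⟨h1, by omega, h3, h4, by omega, h6, fun p q hp hp' hq hq' => ?_⟩
    obtain rfl : p = i := by omega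
    obtain rfl : q = k := by omega
    simpa only [Nat.add_sub_cancel] using h

theorem le_add_tsub_of_step {n : ℕ} {g : ℕ → ℤ}
    (hg : ∀ m, m + 1 ≤ n → g (m + 1) = g m ∨ g (m + 1) = g m + 1) {a b : ℕ}
    (ha : a ≤ n) (hb : b ≤ n) : g b ≤ g a + ((b - a : ℕ) : ℤ) := by
  rcases le_total a b with hab | hab
  · induction b, hab using Nat.le_induction with
    | base => simp
    | succ m hm ih =>
      have := ih (by omega)
      rcases hg m hb with h | h <;> omega
  · induction a, hab using Nat.le_induction with
    | base => simp
    | succ m hm ih =>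
      have := ih (by omega)
      rcases hg m ha with h | h <;> omega

/-- The largest corner sum function taking the value `r` at the point `(i, k)`. -/
def maxCornerSum (i k r p q : ℕ) : ℕ := min p (min q (r + (p - i) + (q - k)))

theorem maxCornerSum_le_left (i k r p q : ℕ) : maxCornerSum i k r p q ≤ p :=
  min_le_left _ _

theorem maxCornerSum_le_right (i k r p q : ℕ) : maxCornerSum i k r p q ≤ q :=
  (min_le_right _ _).trans (min_le_left _ _)

theorem maxCornerSum_step_left (i k r p q : ℕ) :
    maxCornerSum i k r p q ≤ maxCornerSum i k r (p + 1) q ∧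
      maxCornerSum i k r (p + 1) q ≤ maxCornerSum i k r p q + 1 := by
  unfold maxCornerSum
  omega

theorem maxCornerSum_step_right (i k r p q : ℕ) :
    maxCornerSum i k r p q ≤ maxCornerSum i k r p (q + 1) ∧
      maxCornerSum i k r p (q + 1) ≤ maxCornerSum i k r p q + 1 := by
  unfold maxCornerSum
  omega

theorem IsCornerSumLike.le_add {n : ℕ} {h : ℕ → ℕ → ℤ} (H : IsCornerSumLike n h) {a b p q : ℕ}
    (ha : a ≤ n) (hb : b ≤ n) (hp : p ≤ n) (hq : q ≤ n) :
    h p q ≤ h a b + ((p - a : ℕ) : ℤ) + ((q - b : ℕ) : ℤ) := by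
  have h1 := le_add_tsub_of_step (g := fun m => h m q) (fun m hm => H.step_left m q hm hq) ha hp
  have h2 := le_add_tsub_of_step (g := fun m => h a m) (fun m hm => H.step_right a m ha hm) hb hq
  omega

theorem IsCornerSumLike.le_maxCornerSum {n : ℕ} {h : ℕ → ℕ → ℤ} (H : IsCornerSumLike n h)
    {i k r p q : ℕ} (hi : i ≤ n) (hk : k ≤ n) (hr : h i k = r) (hp : p ≤ n) (hq : q ≤ n) :
    h p q ≤ maxCornerSum i k r p q := by
  have h1 := H.le_add hi hk hp hq
  have h2 := H.le_add (a := 0) (b := q) (by omega) hq hp hq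
  have h3 := H.le_add (a := p) (b := 0) hp (by omega) hp hq
  rw [H.zero_left] at h2
  rw [H.zero_right] at h3
  unfold maxCornerSum
  omega

/-- If `h` lies strictly below `maxCornerSum i k r` somewhere, then it does so at an
essential point. -/
theorem IsCornerSumLike.exists_essential {n : ℕ} {h : ℕ → ℕ → ℤ} (H : IsCornerSumLike n h)
    {i k r p q : ℕ} (hp : p ≤ n) (hq : q ≤ n) (hlt : h p q < maxCornerSum i k r p q) :
    ∃ a b, h a b < maxCornerSum i k r a b ∧ 1 ≤ a ∧ a + 1 ≤ n ∧ 1 ≤ b ∧ b + 1 ≤ n ∧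
      h a b = h a (b - 1) ∧ h a (b + 1) = h a b + 1 ∧
      h a b = h (a - 1) b ∧ h (a + 1) b = h a b + 1 := by
  classical
  let S := (Finset.range (n + 1) ×ˢ Finset.range (n + 1)).filter
    fun x => h x.1 x.2 < maxCornerSum i k r x.1 x.2
  have hS : ∀ a b, (a, b) ∈ S ↔ (a ≤ n ∧ b ≤ n) ∧ h a b < maxCornerSum i k r a b := by
    intro a b
    simp only [S, Finset.mem_filter, Finset.mem_product, Finset.mem_range, Nat.lt_succ_iff]
  obtain ⟨⟨a, b⟩, hab, hmax⟩ := Finset.exists_max_image S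
    (fun x => (x.1 : ℤ) + x.2 - 2 * h x.1 x.2) ⟨(p, q), (hS p q).2 ⟨⟨hp, hq⟩, hlt⟩⟩
  obtain ⟨⟨ha, hb⟩, hd⟩ := (hS a b).1 hab
  have hmax' : ∀ c d, c ≤ n → d ≤ n → h c d < maxCornerSum i k r c d →
      (c : ℤ) + d - 2 * h c d ≤ a + b - 2 * h a b := fun c d hc hd' hcd =>
    hmax (c, d) ((hS c d).2 ⟨⟨hc, hd'⟩, hcd⟩)
  have hl := maxCornerSum_le_left i k r a b
  have hr := maxCornerSum_le_right i k r a b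
  have ha0 : a ≠ 0 := by
    rintro rfl
    rw [H.zero_left] at hd
    omega
  have hb0 : b ≠ 0 := by
    rintro rfl
    rw [H.zero_right] at hd
    omega
  have han : a ≠ n := by
    rintro rfl
    rw [H.last_left b hb] at hd
    omega
  have hbn : b ≠ n := by
    rintro rfl
    rw [H.last_right a ha] at hd
    omega
  obtain ⟨a, rfl⟩ := Nat.exists_eq_succ_of_ne_zero ha0
  obtain ⟨b, rfl⟩ := Nat.exists_eq_succ_of_ne_zero hb0
  simp only [Nat.succ_eq_add_one] at *
  have s1 := H.step_left a (b + 1) ha hb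
  have s2 := H.step_left (a + 1) (b + 1) (by omega) hb
  have s3 := H.step_right (a + 1) b ha hb
  have s4 := H.step_right (a + 1) (b + 1) ha (by omega)
  have t1 := maxCornerSum_step_left i k r a (b + 1)
  have t2 := maxCornerSum_step_left i k r (a + 1) (b + 1)
  have t3 := maxCornerSum_step_right i k r (a + 1) b
  have t4 := maxCornerSum_step_right i k r (a + 1) (b + 1)
  have m1 := hmax' a (b + 1) (by omega) hb
  have m2 := hmax' (a + 1 + 1) (b + 1) (by omega) hb
  have m3 := hmax' (a + 1) b ha (by omega)
  have m4 := hmax' (a + 1) (b + 1 + 1) ha (by omega)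
  refine ⟨a + 1, b + 1, hd, by omega, by omega, by omega, by omega, ?_, ?_, ?_, ?_⟩ <;>
    try simp only [Nat.add_sub_cancel]
  · rcases s3 with s | s
    · exact s
    · have := m3 (by omega); omega
  · rcases s4 with s | s
    · have := m4 (by omega); omega
    · exact s
  · rcases s1 with s | s
    · exact s
    · have := m1 (by omega); omega
  · rcases s2 with s | s
    · have := m2 (by omega); omega
    · exact s

/-- The underlying function of `blockSwap`. -/
def blockSwapFun (i k r m : ℕ) : ℕ :=
  if m ≤ r then m else if m ≤ i then m + k - r else if m ≤ i + k - r then m + r - i else m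

theorem blockSwapFun_blockSwapFun {i k r : ℕ} (hi : r < i) (hk : r < k) (m : ℕ) :
    blockSwapFun k i r (blockSwapFun i k r m) = m := by
  unfold blockSwapFun
  split_ifs <;> omega

/-- The permutation exchanging the consecutive blocks `(r, i]` and `(i, i + k - r]`. -/
def blockSwap (i k r : ℕ) (hi : r < i) (hk : r < k) : Equiv.Perm ℕ where
  toFun := blockSwapFun i k r
  invFun := blockSwapFun k i r
  left_inv := blockSwapFun_blockSwapFun hi hk
  right_inv := blockSwapFun_blockSwapFun hk hi

theorem blockSwap_isBigrass {n i k r : ℕ} (hi : r < i) (hk : r < k) (hn : i + k ≤ n + r) :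
    IsBigrass n (blockSwap i k r hi hk) := by
  have key : ∀ {i k : ℕ}, r < i → r < k → ∀ m,
      blockSwapFun i k r (m + 1) < blockSwapFun i k r m ↔ m = i := by
    intro i k hi hk m
    unfold blockSwapFun
    split_ifs <;> omega
  have h1 : ∀ m, (blockSwap i k r hi hk) (m + 1) < blockSwap i k r hi hk m ↔ m = i := key hi hk
  have h2 : ∀ m, (blockSwap i k r hi hk).symm (m + 1) < (blockSwap i k r hi hk).symm m ↔ m = k :=
    key hk hi
  refine ⟨(k, i), ⟨by constructor <;> simp only <;> omega, (h2 k).2 rfl, (h1 i).2 rfl⟩, ?_⟩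
  rintro ⟨a, b⟩ ⟨-, ha, hb⟩
  exact Prod.ext ((h2 a).1 ha) ((h1 b).1 hb)

theorem maxCornerSum_mixed_difference {i k r : ℕ} (hi : r < i) (hk : r < k) (p q : ℕ) :
    (maxCornerSum i k r (p + 1) (q + 1) : ℤ) - maxCornerSum i k r p (q + 1)
      - maxCornerSum i k r (p + 1) q + maxCornerSum i k r p q =
    PermMatrixZ (blockSwap i k r hi hk) (p + 1) (q + 1) := by
  change _ = if blockSwapFun i k r (p + 1) = q + 1 then (1 : ℤ) else 0
  have hle : ∀ p q, maxCornerSum i k r (p + 1) q =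
      maxCornerSum i k r p q + if blockSwapFun i k r (p + 1) ≤ q then 1 else 0 := by
    intro p q
    unfold maxCornerSum blockSwapFun
    split_ifs <;> omega
  rw [hle p (q + 1), hle p q]
  push_cast
  split_ifs <;> omega

theorem sum_Icc_ite_eq (x q : ℕ) (hx : 1 ≤ x) :
    (∑ k ∈ Finset.Icc 1 q, if x = k then (1 : ℤ) else 0) = if x ≤ q then 1 else 0 := by
  rw [Finset.sum_ite_eq]
  simp [hx]

theorem mem_Icc_of_fixes {n : ℕ} {u : Equiv.Perm ℕ} (hu : ∀ m, m ∉ Finset.Icc 1 n → u m = m)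
    {m : ℕ} (hm : m ∈ Finset.Icc 1 n) : u m ∈ Finset.Icc 1 n := by
  by_contra h
  rw [u.injective (hu _ h)] at h
  exact h hm

section PermMatrix

variable {n : ℕ} {A : ℕ → ℕ → ℤ} {u : Equiv.Perm ℕ}

theorem cornerSum_succ_left_of_perm (hu : ∀ m, m ∉ Finset.Icc 1 n → u m = m)
    (hAu : ∀ i ∈ Finset.Icc 1 n, ∀ j ∈ Finset.Icc 1 n, A i j = PermMatrixZ u i j)
    {p q : ℕ} (hp : p + 1 ≤ n) (hq : q ≤ n) :
    cornerSum A (p + 1) q = cornerSum A p q + if u (p + 1) ≤ q then 1 else 0 := by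
  have hm : p + 1 ∈ Finset.Icc 1 n := by simp; omega
  rw [cornerSum_succ_left, ← sum_Icc_ite_eq _ q (Finset.mem_Icc.1 (mem_Icc_of_fixes hu hm)).1]
  congr 1
  refine Finset.sum_congr rfl fun k hk => ?_
  rw [hAu _ hm k (by simp at hk ⊢; omega), PermMatrixZ]

theorem cornerSum_succ_right_of_perm (hu : ∀ m, m ∉ Finset.Icc 1 n → u.symm m = m)
    (hAu : ∀ i ∈ Finset.Icc 1 n, ∀ j ∈ Finset.Icc 1 n, A i j = PermMatrixZ u i j)
    {p q : ℕ} (hp : p ≤ n) (hq : q + 1 ≤ n) :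
    cornerSum A p (q + 1) = cornerSum A p q + if u.symm (q + 1) ≤ p then 1 else 0 := by
  have hm : q + 1 ∈ Finset.Icc 1 n := by simp; omega
  rw [cornerSum_succ_right, ← sum_Icc_ite_eq _ p (Finset.mem_Icc.1 (mem_Icc_of_fixes hu hm)).1]
  congr 1
  refine Finset.sum_congr rfl fun k hk => ?_
  rw [hAu k (by simp at hk ⊢; omega) _ hm, PermMatrixZ]
  exact if_congr (by rw [Equiv.symm_apply_eq, eq_comm]) rfl rfl

/-- The essential points of a permutation matrix. -/
theorem essRect_point_iff_of_perm (hu : ∀ m, m ∉ Finset.Icc 1 n → u m = m)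
    (hAu : ∀ i ∈ Finset.Icc 1 n, ∀ j ∈ Finset.Icc 1 n, A i j = PermMatrixZ u i j) {i k : ℕ}
    (hi : 1 ≤ i) (hin : i + 1 ≤ n) (hk : 1 ≤ k) (hkn : k + 1 ≤ n) :
    EssRect n A i (i + 1) k (k + 1) ↔
      i < u.symm k ∧ u.symm (k + 1) ≤ i ∧ k < u i ∧ u (i + 1) ≤ k := by
  have hu' : ∀ m, m ∉ Finset.Icc 1 n → u.symm m = m := fun m hm => by
    rw [Equiv.symm_apply_eq, hu m hm]
  rw [essRect_point_iff]
  obtain ⟨a, rfl⟩ := Nat.exists_eq_add_of_le' hi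
  obtain ⟨b, rfl⟩ := Nat.exists_eq_add_of_le' hk
  simp only [Nat.add_sub_cancel]
  rw [cornerSum_succ_right_of_perm hu' hAu (p := a + 1) (q := b + 1) (by omega) hkn,
    cornerSum_succ_left_of_perm hu hAu (p := a + 1) (q := b + 1) hin (by omega)]
  have e1 := cornerSum_succ_right_of_perm hu' hAu (p := a + 1) (q := b) (by omega) (by omega)
  have e2 := cornerSum_succ_left_of_perm hu hAu (p := a) (q := b + 1) (by omega) (by omega)
  split_ifs at * <;> omega

end PermMatrix

theorem le_of_no_descent {u : ℕ → ℕ} {a b : ℕ} (hab : a ≤ b)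
    (h : ∀ m, a ≤ m → m < b → ¬ u (m + 1) < u m) : u a ≤ u b := by
  induction b, hab using Nat.le_induction with
  | base => exact le_rfl
  | succ m hm ih =>
    exact (ih fun c hc hc' => h c hc (by omega)).trans (not_lt.1 (h m hm (by omega)))

theorem existsUnique_essPoint_of_isBigrass {n : ℕ} {A : ℕ → ℕ → ℤ} {u : Equiv.Perm ℕ}
    (hu : ∀ m, m ∉ Finset.Icc 1 n → u m = m)
    (hAu : ∀ i ∈ Finset.Icc 1 n, ∀ j ∈ Finset.Icc 1 n, A i j = PermMatrixZ u i j)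
    (hb : IsBigrass n u) :
    ∃! p : ℕ × ℕ, (1 ≤ p.1 ∧ p.1 ≤ n - 1 ∧ 1 ≤ p.2 ∧ p.2 ≤ n - 1) ∧
      EssRect n A p.1 (p.1 + 1) p.2 (p.2 + 1) := by
  obtain ⟨⟨k, i⟩, ⟨⟨hk, hkn, hi, hin⟩, hdk, hdi⟩, huniq⟩ := hb
  simp only at hk hkn hi hin hdk hdi
  have hdesc : ∀ m, 1 ≤ m → m ≤ n - 1 → u (m + 1) < u m → m = i := fun m h1 h2 h3 =>
    congrArg Prod.snd (huniq (k, m) ⟨⟨hk, hkn, h1, h2⟩, hdk, h3⟩)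
  have hu' : ∀ m, m ∉ Finset.Icc 1 n → u.symm m = m := fun m hm => by
    rw [Equiv.symm_apply_eq, hu m hm]
  have hsk := Finset.mem_Icc.1 (mem_Icc_of_fixes hu' (m := k) (by simp; omega))
  have hsk' := Finset.mem_Icc.1 (mem_Icc_of_fixes hu' (m := k + 1) (by simp; omega))
  have huk := u.apply_symm_apply k
  have huk' := u.apply_symm_apply (k + 1)
  have hmono : ∀ a b, 1 ≤ a → b ≤ n → a ≤ b → (b ≤ i ∨ i < a) → u a ≤ u b :=
    fun a b ha hb hab h => le_of_no_descent hab fun m h1 h2 h3 => by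
      have := hdesc m (by omega) (by omega) h3
      omega
  have hb : i < u.symm k := by
    by_contra hcon
    have := hmono (u.symm (k + 1)) (u.symm k) (by omega) (by omega) hdk.le (by omega)
    omega
  have ha : u.symm (k + 1) ≤ i := by
    by_contra hcon
    have := hmono (u.symm (k + 1)) (u.symm k) (by omega) (by omega) hdk.le (by omega)
    omega
  have hui := hmono (u.symm (k + 1)) i (by omega) (by omega) ha (by omega)
  have hui' := hmono (i + 1) (u.symm k) (by omega) (by omega) hb (by omega)
  refine ⟨(i, k), ⟨⟨hi, hin, hk, hkn⟩, (essRect_point_iff_of_perm hu hAu hi (by omega) hk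
    (by omega)).2 ⟨hb, ha, by omega, by omega⟩⟩, ?_⟩
  rintro ⟨a, b⟩ ⟨⟨h1, h2, h3, h4⟩, hess⟩
  simp only at h1 h2 h3 h4 hess
  obtain ⟨c1, c2, c3, c4⟩ :=
    (essRect_point_iff_of_perm hu hAu h1 (by omega) h3 (by omega)).1 hess
  have := huniq (b, a) ⟨⟨h3, h4, h1, h2⟩, c2.trans_lt c1, c4.trans_lt c3⟩
  obtain ⟨rfl, rfl⟩ := Prod.mk.inj this
  rfl

/-- an ASM `A` is the permutation matrix of a bigrassmannian permutation iff
`A` has exactly one essential point. -/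
theorem bigrass_iff_unique_essPoint (n : ℕ) (A : ℕ → ℕ → ℤ) (hA : IsASM n A) :
    (∃ u : Equiv.Perm ℕ, (∀ m, m ∉ Finset.Icc 1 n → u m = m) ∧
        (∀ i ∈ Finset.Icc 1 n, ∀ j ∈ Finset.Icc 1 n, A i j = PermMatrixZ u i j) ∧
        IsBigrass n u) ↔
    (∃! p : ℕ × ℕ, (1 ≤ p.1 ∧ p.1 ≤ n - 1 ∧ 1 ≤ p.2 ∧ p.2 ≤ n - 1) ∧
        EssRect n A p.1 (p.1 + 1) p.2 (p.2 + 1)) := by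
  constructor
  · rintro ⟨u, hu, hAu, hb⟩
    exact existsUnique_essPoint_of_isBigrass hu hAu hb
  · rintro ⟨⟨i, k⟩, ⟨-, hess⟩, huniq⟩
    have H := hA.isCornerSumLike
    simp only at hess
    obtain ⟨hi, hin, hk, hkn, e1, -, e3, -⟩ := essRect_point_iff.1 hess
    have b0 := H.le_add (a := i) (b := k) (p := 0) (q := k) (by omega) (by omega) (by omega)
      (by omega)
    rw [H.zero_left] at b0
    obtain ⟨r, hr⟩ := Int.eq_ofNat_of_zero_le (a := cornerSum A i k) (by omega)
    have b1 := H.le_add (a := 0) (b := k) (p := i - 1) (q := k) (by omega) (by omega) (by omega)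
      (by omega)
    have b2 := H.le_add (a := i) (b := 0) (p := i) (q := k - 1) (by omega) (by omega) (by omega)
      (by omega)
    have b3 := H.le_add (a := i) (b := k) (p := i) (q := n) (by omega) (by omega) (by omega)
      (by omega)
    rw [H.zero_left] at b1
    rw [H.zero_right] at b2
    rw [H.last_right i (by omega)] at b3
    have hri : r < i := by omega
    have hrk : r < k := by omega
    have heq : ∀ p q, p ≤ n → q ≤ n → cornerSum A p q = maxCornerSum i k r p q := by
      intro p q hp hq
      refine le_antisymm (H.le_maxCornerSum (by omega) (by omega) hr hp hq) (not_lt.1 fun hlt => ?_)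
      obtain ⟨a, b, hab, ha, han, hb, hbn, hrest⟩ := H.exists_essential hp hq hlt
      have := huniq (a, b) ⟨⟨ha, by simp only; omega, hb, by simp only; omega⟩,
        essRect_point_iff.2 ⟨ha, han, hb, hbn, hrest⟩⟩
      obtain ⟨rfl, rfl⟩ := Prod.mk.inj this
      rw [hr] at hab
      unfold maxCornerSum at hab
      omega
    refine ⟨blockSwap i k r hri hrk, fun m hm => ?_, fun p hp q hq => ?_,
      blockSwap_isBigrass hri hrk (by omega)⟩
    · change blockSwapFun i k r m = m
      rw [Finset.mem_Icc] at hm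
      unfold blockSwapFun
      split_ifs <;> omega
    · rw [Finset.mem_Icc] at hp hq
      obtain ⟨p, rfl⟩ := Nat.exists_eq_add_of_le' hp.1
      obtain ⟨q, rfl⟩ := Nat.exists_eq_add_of_le' hq.1
      rw [entry_eq_cornerSum A, ← maxCornerSum_mixed_difference, heq _ _ hp.2 hq.2,
        heq p (q + 1) (by omega) hq.2, heq (p + 1) q hp.2 (by omega),
        heq p q (by omega) (by omega)]
end

section
/- For every permutation w ∈ S_n, 2·β(w) = Σ_{i=1}^{n} (i − w(i))², where β(w) denotes the bigrassmannian statistic of the permutation matrix of w (equivalently, β(w) = Σ_{i=1}^{n} (1/2)(i − w(i))²). -/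
theorem sum_Icc_sum_Icc_one (n : ℕ) (f : ℕ → ℤ) :
    ∑ i ∈ Finset.Icc 1 n, ∑ p ∈ Finset.Icc 1 i, f p =
      ∑ p ∈ Finset.Icc 1 n, ((n : ℤ) + 1 - p) * f p := by
  induction n with
  | zero => simp
  | succ n ih =>
    rw [Finset.sum_Icc_succ_top (by omega), ih, Finset.sum_Icc_succ_top (by omega),
      Finset.sum_Icc_succ_top (by omega), ← add_assoc, ← Finset.sum_add_distrib]
    push_cast
    congr 1
    · exact Finset.sum_congr rfl fun p _ => by ring
    · ring

theorem sum_cornerSum (n : ℕ) (A : ℕ → ℕ → ℤ) :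
    ∑ i ∈ Finset.Icc 1 n, ∑ j ∈ Finset.Icc 1 n, cornerSum A i j =
      ∑ p ∈ Finset.Icc 1 n, ∑ q ∈ Finset.Icc 1 n,
        ((n : ℤ) + 1 - p) * (((n : ℤ) + 1 - q) * A p q) := by
  have h (i : ℕ) : ∑ j ∈ Finset.Icc 1 n, cornerSum A i j =
      ∑ p ∈ Finset.Icc 1 i, ∑ q ∈ Finset.Icc 1 n, ((n : ℤ) + 1 - q) * A p q := by
    simp only [cornerSum]
    rw [Finset.sum_comm]
    exact Finset.sum_congr rfl fun p _ => sum_Icc_sum_Icc_one n (A p)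
  simp only [h, sum_Icc_sum_Icc_one, Finset.mul_sum]

theorem cornerSum_PermMatrixZ_one (i j : ℕ) :
    cornerSum (PermMatrixZ 1) i j = (min i j : ℤ) := by
  have h : ((Finset.Icc 1 i).filter fun p => (1 : Equiv.Perm ℕ) p ∈ Finset.Icc 1 j) =
      Finset.Icc 1 (min i j) := by
    ext p
    simp only [Finset.mem_filter, Finset.mem_Icc, Equiv.Perm.one_apply]
    omega
  simp only [cornerSum, PermMatrixZ, Finset.sum_ite_eq]
  rw [← Finset.sum_filter, h]
  simp

theorem sum_cornerSum_PermMatrixZ (n : ℕ) (u : Equiv.Perm ℕ)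
    (hu : ∀ m ∈ Finset.Icc 1 n, u m ∈ Finset.Icc 1 n) :
    ∑ i ∈ Finset.Icc 1 n, ∑ j ∈ Finset.Icc 1 n, cornerSum (PermMatrixZ u) i j =
      ∑ p ∈ Finset.Icc 1 n, ((n : ℤ) + 1 - p) * ((n : ℤ) + 1 - u p) := by
  rw [sum_cornerSum]
  refine Finset.sum_congr rfl fun p hp => ?_
  simp only [PermMatrixZ, mul_ite, mul_one, mul_zero, Finset.sum_ite_eq, if_pos (hu p hp)]

/-- for every permutation `w ∈ S_n`, `2·β(w) = Σ_i (i − w(i))²` where `β(w)`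
is the bigrassmannian statistic of the permutation matrix of `w`. -/
theorem two_beta_perm_eq_sum (n : ℕ) (u : Equiv.Perm ℕ)
    (hu : ∀ m, m ∉ Finset.Icc 1 n → u m = m) :
    2 * asmBeta n (PermMatrixZ u) =
      ∑ i ∈ Finset.Icc 1 n, ((i : ℤ) - (u i : ℤ)) ^ 2 := by
  have hmem (m : ℕ) (hm : m ∈ Finset.Icc 1 n) : u m ∈ Finset.Icc 1 n := by
    by_contra h
    exact h ((u.injective (hu _ h)).symm ▸ hm)
  have hmin : ∑ i ∈ Finset.Icc 1 n, ∑ j ∈ Finset.Icc 1 n, (min i j : ℤ) =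
      ∑ p ∈ Finset.Icc 1 n, ((n : ℤ) + 1 - p) ^ 2 := by
    simp only [← cornerSum_PermMatrixZ_one]
    rw [sum_cornerSum_PermMatrixZ n 1 fun m hm => hm]
    exact Finset.sum_congr rfl fun p _ => (sq _).symm
  have hperm : ∑ p ∈ Finset.Icc 1 n, ((n : ℤ) + 1 - u p) ^ 2 =
      ∑ p ∈ Finset.Icc 1 n, ((n : ℤ) + 1 - p) ^ 2 :=
    Equiv.Perm.sum_comp u (Finset.Icc 1 n) (fun p => ((n : ℤ) + 1 - p) ^ 2) fun m hm => by
      by_contra h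
      exact hm (hu m h)
  rw [asmBeta, hmin, sum_cornerSum_PermMatrixZ n u hmem, mul_sub, two_mul]
  nth_rewrite 2 [← hperm]
  rw [Finset.mul_sum, ← Finset.sum_add_distrib, ← Finset.sum_sub_distrib]
  exact Finset.sum_congr rfl fun p _ => by ring
end

section
/- (Characterization of ASM order by total nonnegativity) Let A and B be alternating sign matrices of size n. Then A ≤ B in ASM order if and only if for every totally nonnegative real n×n matrix M=(m_{ij}) all of whose entries are positive, Π_{i,j} m_{ij}^{a_{ij}} ≥ Π_{i,j} m_{ij}^{b_{ij}}. -/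
/-- Summation by parts on `1..n`. -/
theorem sum_Icc_mul_eq_sum_partial_sums (d l : ℕ → ℝ) (n : ℕ) :
    ∑ p ∈ Finset.Icc 1 n, d p * l p =
      ∑ p ∈ Finset.Icc 1 n, (∑ k ∈ Finset.Icc 1 p, d k) * (l p - l (p + 1)) +
        (∑ k ∈ Finset.Icc 1 n, d k) * l (n + 1) := by
  induction n with
  | zero => simp
  | succ n ih =>
    rw [Finset.sum_Icc_succ_top (by omega), ih, Finset.sum_Icc_succ_top (by omega),
      Finset.sum_Icc_succ_top (by omega) (fun k => d k)]
    ring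

/-- Two-dimensional summation by parts for an array with vanishing row and column sums. -/
theorem sum_mul_eq_sum_corner_mul (n : ℕ) (D L : ℕ → ℕ → ℝ)
    (hrow : ∀ p ∈ Finset.Icc 1 n, ∑ q ∈ Finset.Icc 1 n, D p q = 0)
    (hcol : ∀ q ∈ Finset.Icc 1 n, ∑ p ∈ Finset.Icc 1 n, D p q = 0) :
    ∑ p ∈ Finset.Icc 1 n, ∑ q ∈ Finset.Icc 1 n, D p q * L p q =
      ∑ q ∈ Finset.Icc 1 n, ∑ p ∈ Finset.Icc 1 n,
        (∑ p' ∈ Finset.Icc 1 p, ∑ q' ∈ Finset.Icc 1 q, D p' q') *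
          ((L p q - L p (q + 1)) - (L (p + 1) q - L (p + 1) (q + 1))) := by
  have inner : ∀ p ∈ Finset.Icc 1 n, ∑ q ∈ Finset.Icc 1 n, D p q * L p q =
      ∑ q ∈ Finset.Icc 1 n, (∑ k ∈ Finset.Icc 1 q, D p k) * (L p q - L p (q + 1)) := by
    intro p hp
    rw [sum_Icc_mul_eq_sum_partial_sums, hrow p hp]
    ring
  rw [Finset.sum_congr rfl inner, Finset.sum_comm]
  refine Finset.sum_congr rfl fun q hq => ?_
  have hzero : ∑ p ∈ Finset.Icc 1 n, ∑ k ∈ Finset.Icc 1 q, D p k = 0 := by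
    rw [Finset.sum_comm]
    refine Finset.sum_eq_zero fun k hk => hcol k ?_
    simp only [Finset.mem_Icc] at hk hq ⊢
    omega
  rw [sum_Icc_mul_eq_sum_partial_sums (fun p => ∑ k ∈ Finset.Icc 1 q, D p k)
    (fun p => L p q - L p (q + 1)), hzero]
  ring

theorem asmMon_pos {n : ℕ} {M : ℕ → ℕ → ℝ} (A : ℕ → ℕ → ℤ)
    (hM : ∀ p ∈ Finset.Icc 1 n, ∀ q ∈ Finset.Icc 1 n, 0 < M p q) : 0 < asmMon n A M :=
  Finset.prod_pos fun p hp => Finset.prod_pos fun q hq => zpow_pos (hM p hp q hq) _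

theorem log_asmMon {n : ℕ} {M : ℕ → ℕ → ℝ} (A : ℕ → ℕ → ℤ)
    (hM : ∀ p ∈ Finset.Icc 1 n, ∀ q ∈ Finset.Icc 1 n, 0 < M p q) :
    Real.log (asmMon n A M) =
      ∑ p ∈ Finset.Icc 1 n, ∑ q ∈ Finset.Icc 1 n, (A p q : ℝ) * Real.log (M p q) := by
  rw [asmMon, Real.log_prod fun p hp =>
    (Finset.prod_pos fun q hq => zpow_pos (hM p hp q hq) _).ne']
  refine Finset.sum_congr rfl fun p hp => ?_
  rw [Real.log_prod fun q hq => (zpow_pos (hM p hp q hq) _).ne']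
  exact Finset.sum_congr rfl fun q _ => Real.log_zpow _ _

theorem cornerSum_last_row {n : ℕ} {A : ℕ → ℕ → ℤ} (hA : IsASM n A) {q : ℕ} (hq : q ≤ n) :
    cornerSum A n q = q := by
  rw [cornerSum, Finset.sum_comm, Finset.sum_congr rfl fun k hk =>
    hA.2.2.2.2 k (Finset.mem_Icc.2 ⟨(Finset.mem_Icc.1 hk).1, (Finset.mem_Icc.1 hk).2.trans hq⟩)]
  simp

theorem cornerSum_last_col {n : ℕ} {A : ℕ → ℕ → ℤ} (hA : IsASM n A) {p : ℕ} (hp : p ≤ n) :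
    cornerSum A p n = p := by
  rw [cornerSum, Finset.sum_congr rfl fun k hk =>
    hA.2.2.2.1 k (Finset.mem_Icc.2 ⟨(Finset.mem_Icc.1 hk).1, (Finset.mem_Icc.1 hk).2.trans hp⟩)]
  simp

theorem IsTNNReal.adjacent_minor_nonneg {n : ℕ} {M : ℕ → ℕ → ℝ} (hM : IsTNNReal n M) {p q : ℕ}
    (hp : 1 ≤ p) (hpn : p < n) (hq : 1 ≤ q) (hqn : q < n) :
    M p (q + 1) * M (p + 1) q ≤ M p q * M (p + 1) (q + 1) := by
  have h := hM 2 ![p, p + 1] ![q, q + 1] (by simp [Fin.strictMono_iff_lt_succ])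
    (by simp [Fin.strictMono_iff_lt_succ])
    (by simp [Fin.forall_fin_two]; omega) (by simp [Fin.forall_fin_two]; omega)
  simpa [Matrix.det_fin_two] using h

theorem asmMon_le_of_asmle {n : ℕ} {A B : ℕ → ℕ → ℤ} (hA : IsASM n A) (hB : IsASM n B)
    (hAB : ASMLE n A B) {M : ℕ → ℕ → ℝ} (hM : IsTNNReal n M)
    (hpos : ∀ p ∈ Finset.Icc 1 n, ∀ q ∈ Finset.Icc 1 n, 0 < M p q) :
    asmMon n B M ≤ asmMon n A M := by
  rw [← Real.log_le_log_iff (asmMon_pos B hpos) (asmMon_pos A hpos), log_asmMon A hpos,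
    log_asmMon B hpos, ← sub_nonneg, ← Finset.sum_sub_distrib]
  simp_rw [← Finset.sum_sub_distrib, ← sub_mul]
  rw [sum_mul_eq_sum_corner_mul n (fun p q => (A p q : ℝ) - B p q) (fun p q => Real.log (M p q))]
  · refine Finset.sum_nonneg fun q hq => Finset.sum_nonneg fun p hp => ?_
    have hcorner : ∑ p' ∈ Finset.Icc 1 p, ∑ q' ∈ Finset.Icc 1 q, ((A p' q' : ℝ) - B p' q') =
        ((cornerSum A p q - cornerSum B p q : ℤ) : ℝ) := by
      simp [cornerSum, Finset.sum_sub_distrib]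
    rw [hcorner]
    have hle := hAB p hp q hq
    rw [Finset.mem_Icc] at hp hq
    rcases hp.2.eq_or_lt with rfl | hpn
    · simp [cornerSum_last_row hA hq.2, cornerSum_last_row hB hq.2]
    rcases hq.2.eq_or_lt with rfl | hqn
    · simp [cornerSum_last_col hA hp.2, cornerSum_last_col hB hp.2]
    have mpos : ∀ {i j : ℕ}, 1 ≤ i → i ≤ n → 1 ≤ j → j ≤ n → 0 < M i j := fun h₁ h₂ h₃ h₄ =>
      hpos _ (Finset.mem_Icc.2 ⟨h₁, h₂⟩) _ (Finset.mem_Icc.2 ⟨h₃, h₄⟩)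
    have h00 := mpos hp.1 hp.2 hq.1 hq.2
    have h01 := mpos hp.1 hp.2 (Nat.le_add_left 1 q) hqn
    have h10 := mpos (Nat.le_add_left 1 p) hpn hq.1 hq.2
    have h11 := mpos (Nat.le_add_left 1 p) hpn (Nat.le_add_left 1 q) hqn
    have hlog := Real.log_le_log (mul_pos h01 h10)
      (hM.adjacent_minor_nonneg hp.1 hpn hq.1 hqn)
    rw [Real.log_mul h01.ne' h10.ne', Real.log_mul h00.ne' h11.ne'] at hlog
    refine mul_nonneg (by exact_mod_cast sub_nonneg.2 hle) (by linarith)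
  · intro p hp
    rw [Finset.sum_sub_distrib, ← Int.cast_sum, ← Int.cast_sum, hA.2.2.2.1 p hp, hB.2.2.2.1 p hp,
      sub_self]
  · intro q hq
    rw [Finset.sum_sub_distrib, ← Int.cast_sum, ← Int.cast_sum, hA.2.2.2.2 q hq, hB.2.2.2.2 q hq,
      sub_self]

/-- The array equal to `2` on the upper left `i × j` corner and to `1` elsewhere. -/
def cornerArray (i j : ℕ) : ℕ → ℕ → ℝ :=
  fun p q => if p ≤ i ∧ q ≤ j then 2 else 1

theorem cornerArray_pos (i j p q : ℕ) : 0 < cornerArray i j p q := by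
  unfold cornerArray
  split_ifs <;> norm_num

theorem isTNNReal_cornerArray (n i j : ℕ) : IsTNNReal n (cornerArray i j) := by
  intro r f g hf hg _ _
  match r with
  | 0 => simp
  | 1 => simpa using (cornerArray_pos i j (f 0) (g 0)).le
  | 2 =>
    have hf01 : f 0 < f 1 := hf (by simp)
    have hg01 : g 0 < g 1 := hg (by simp)
    simp only [Matrix.det_fin_two, Matrix.of_apply, cornerArray]
    split_ifs <;> first | omega | norm_num
  | r + 3 =>
    -- every row is determined by whether its index is at most `i`, so two rows coincide
    obtain ⟨a, b, hab, hiff⟩ : ∃ a b : Fin (r + 3), a ≠ b ∧ (f a ≤ i ↔ f b ≤ i) := by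
      obtain ⟨a, b, hab, h⟩ := Fintype.exists_ne_map_eq_of_card_lt
        (fun a : Fin (r + 3) => decide (f a ≤ i)) (by simp)
      exact ⟨a, b, hab, by simpa using h⟩
    refine (Matrix.det_zero_of_row_eq hab ?_).ge
    funext c
    simp only [Matrix.of_apply, cornerArray, hiff]

theorem asmMon_cornerArray {n i j : ℕ} (A : ℕ → ℕ → ℤ) (hi : i ≤ n) (hj : j ≤ n) :
    asmMon n A (cornerArray i j) = 2 ^ cornerSum A i j := by
  have hfactor : ∀ p q, cornerArray i j p q ^ A p q =
      (2 : ℝ) ^ (if p ≤ i then if q ≤ j then A p q else 0 else 0) := by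
    intro p q
    by_cases hp : p ≤ i <;> by_cases hq : q ≤ j <;> simp [cornerArray, hp, hq]
  have hprod : ∀ (s : Finset ℕ) (e : ℕ → ℤ), ∏ k ∈ s, (2 : ℝ) ^ e k = 2 ^ ∑ k ∈ s, e k := by
    intro s e
    induction s using Finset.cons_induction with
    | empty => simp
    | cons a s ha ih => rw [Finset.prod_cons, Finset.sum_cons, ih, zpow_add₀ two_ne_zero]
  have hfilter : ∀ k, k ≤ n → (Finset.Icc 1 n).filter (· ≤ k) = Finset.Icc 1 k := by
    intro k hk
    ext x
    simp only [Finset.mem_filter, Finset.mem_Icc]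
    omega
  simp only [asmMon, hfactor, hprod, cornerSum]
  congr 1
  rw [← hfilter i hi, Finset.sum_filter, ← hfilter j hj]
  refine Finset.sum_congr rfl fun p _ => ?_
  split_ifs
  · rw [Finset.sum_filter]
  · simp

/-- characterization of ASM order by total nonnegativity: `A ≤ B` iff
`x^A(M) ≥ x^B(M)` for every totally nonnegative real matrix `M` with positive entries. -/
theorem asmle_iff_tnn (n : ℕ) (A B : ℕ → ℕ → ℤ) (hA : IsASM n A) (hB : IsASM n B) :
    ASMLE n A B ↔
      ∀ M : ℕ → ℕ → ℝ, IsTNNReal n M →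
        (∀ p ∈ Finset.Icc 1 n, ∀ q ∈ Finset.Icc 1 n, 0 < M p q) →
        asmMon n B M ≤ asmMon n A M := by
  refine ⟨fun h M hM hpos => asmMon_le_of_asmle hA hB h hM hpos, fun h i hi j hj => ?_⟩
  have hij := h (cornerArray i j) (isTNNReal_cornerArray n i j)
    fun p _ q _ => cornerArray_pos i j p q
  rwa [asmMon_cornerArray A (Finset.mem_Icc.1 hi).2 (Finset.mem_Icc.1 hj).2,
    asmMon_cornerArray B (Finset.mem_Icc.1 hi).2 (Finset.mem_Icc.1 hj).2,
    zpow_le_zpow_iff_right₀ one_lt_two] at hij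
end
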